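/- Exactly 4 of the 11 isomorphism classes of simple graphs on 4 vertices are universally solvable; that is, the set of isomorphism classes of simple graphs on a 4-element vertex set whose members are universally solvable has cardinality 4. -/

import Mathlib

open scoped Classical in
/-- The neighborhood matrix of a simple graph `G` over the field `ℤ/2ℤ`:
its `(u, v)` entry is `1` if `u = v` or `u` is adjacent to `v`, and `0` otherwise. -/
noncomputable def neighborhoodMatrix {V : Type*} [Fintype V]
    (G : SimpleGraph V) : Matrix V V (ZMod 2) :=
  fun u v => if u = v ∨ G.Adj u v then 1 else 0

/-- Lights Out on `G` is universally solvable: every configuration `b` can be obtained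
by pressing some set of vertices `x`. -/
def UniversallySolvable {V : Type*} [Fintype V] (G : SimpleGraph V) : Prop :=
  ∀ b : V → ZMod 2, ∃ x : V → ZMod 2, (neighborhoodMatrix G).mulVec x = b

/-- The setoid on labeled simple graphs with vertex set `V` whose equivalence classes are
the isomorphism classes of simple graphs. -/
def graphIsoSetoid (V : Type*) : Setoid (SimpleGraph V) where
  r G H := Nonempty (G ≃g H)
  iseqv := ⟨fun G => ⟨SimpleGraph.Iso.refl⟩,
    fun ⟨e⟩ => ⟨e.symm⟩, fun ⟨e⟩ ⟨f⟩ => ⟨e.trans f⟩⟩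

section LightsOut

variable {V : Type*} [Fintype V]

theorem neighborhoodMatrix_eq_of [DecidableEq V] (G : SimpleGraph V) [DecidableRel G.Adj] :
    neighborhoodMatrix G = Matrix.of fun u v => if u = v ∨ G.Adj u v then 1 else 0 := by
  ext u v
  simp only [neighborhoodMatrix, Matrix.of_apply]
  congr

/-- Lights Out is universally solvable iff there is no nontrivial quiet pattern. -/
theorem universallySolvable_iff_forall_mulVec_eq_zero (G : SimpleGraph V) :
    UniversallySolvable G ↔ ∀ x, (neighborhoodMatrix G).mulVec x = 0 → x = 0 := by
  have h := LinearMap.injective_iff_surjective (f := (neighborhoodMatrix G).mulVecLin)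
  rw [injective_iff_map_eq_zero] at h
  exact h.symm

theorem UniversallySolvable.of_iso {W : Type*} [Fintype W] {G : SimpleGraph V}
    {H : SimpleGraph W} (e : G ≃g H) (hG : UniversallySolvable G) : UniversallySolvable H := by
  intro b
  obtain ⟨x, hx⟩ := hG (b ∘ e)
  refine ⟨x ∘ e.symm, funext fun w => ?_⟩
  have hw := congrFun hx (e.symm w)
  simp only [Function.comp_apply, RelIso.apply_symm_apply] at hw
  rw [← hw]
  refine (Fintype.sum_equiv e.toEquiv _ _ fun v => ?_).symm
  have hadj : G.Adj (e.symm w) v ↔ H.Adj w (e v) := by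
    rw [← e.map_adj_iff, RelIso.apply_symm_apply]
  have heq : e.symm w = v ↔ w = e v := e.toEquiv.symm_apply_eq
  have hN : neighborhoodMatrix G (e.symm w) v = neighborhoodMatrix H w (e v) := by
    unfold neighborhoodMatrix
    congr 1
    exact propext (or_congr heq hadj)
  change neighborhoodMatrix G (e.symm w) v * x v =
    neighborhoodMatrix H w (e v) * x (e.symm (e v))
  rw [hN, RelIso.symm_apply_apply]

instance [DecidableEq V] (G : SimpleGraph V) [DecidableRel G.Adj] :
    Decidable (UniversallySolvable G) :=
  decidable_of_iff
    (∀ x : V → ZMod 2,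
      (∀ u, ∑ v, (if u = v ∨ G.Adj u v then 1 else 0) * x v = 0) → ∀ u, x u = 0) <| by
    rw [universallySolvable_iff_forall_mulVec_eq_zero, neighborhoodMatrix_eq_of]
    simp only [funext_iff]
    rfl

end LightsOut

/-- The simple graph on four vertices whose edges are flagged by six Booleans. -/
def fourVertexGraph (a b c d e f : Bool) : SimpleGraph (Fin 4) where
  Adj u v := !![false, a, b, c; a, false, d, e; b, d, false, f; c, e, f, false] u v = true
  symm := ⟨by intro u v; fin_cases u <;> fin_cases v <;> exact id⟩
  loopless := ⟨by intro u; fin_cases u <;> exact Bool.false_ne_true⟩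

instance (a b c d e f : Bool) : DecidableRel (fourVertexGraph a b c d e f).Adj :=
  fun _ _ => inferInstanceAs (Decidable (_ = true))

theorem exists_eq_fourVertexGraph (G : SimpleGraph (Fin 4)) :
    ∃ a b c d e f, G = fourVertexGraph a b c d e f := by
  classical
  refine ⟨decide (G.Adj 0 1), decide (G.Adj 0 2), decide (G.Adj 0 3), decide (G.Adj 1 2),
    decide (G.Adj 1 3), decide (G.Adj 2 3), ?_⟩
  ext u v
  fin_cases u <;> fin_cases v <;> simp [fourVertexGraph] <;>
    exact G.adj_comm _ _

/-- The edgeless graph, the disjoint union of a 3-vertex path and a point, the 4-vertex path,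
and the 4-cycle. -/
def solvableRepresentative (i : Fin 4) : SimpleGraph (Fin 4) :=
  fourVertexGraph (i ≠ 0) false (i = 3) (i ≠ 0) false (2 ≤ i)

instance (i : Fin 4) : DecidableRel (solvableRepresentative i).Adj :=
  inferInstanceAs (DecidableRel (fourVertexGraph _ _ _ _ _ _).Adj)

theorem universallySolvable_solvableRepresentative (i : Fin 4) :
    UniversallySolvable (solvableRepresentative i) := by
  revert i
  decide +kernel

theorem card_edgeFinset_solvableRepresentative_injective :
    Function.Injective fun i => (solvableRepresentative i).edgeFinset.card := by
  decide +kernel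

theorem UniversallySolvable.exists_iso_solvableRepresentative {G : SimpleGraph (Fin 4)}
    (hG : UniversallySolvable G) : ∃ i, Nonempty (solvableRepresentative i ≃g G) := by
  have key : ∀ a b c d e f, UniversallySolvable (fourVertexGraph a b c d e f) →
      ∃ i, ∃ σ : Equiv.Perm (Fin 4), ∀ u v, (fourVertexGraph a b c d e f).Adj (σ u) (σ v) ↔
        (solvableRepresentative i).Adj u v := by
    decide +kernel
  obtain ⟨a, b, c, d, e, f, rfl⟩ := exists_eq_fourVertexGraph G
  obtain ⟨i, σ, hσ⟩ := key a b c d e f hG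
  exact ⟨i, ⟨⟨σ, hσ _ _⟩⟩⟩

/-- Exactly 4 of the 11 isomorphism classes of simple graphs on 4 vertices are
universally solvable. -/
theorem card_universallySolvable_classes_four :
    Nat.card {q : Quotient (graphIsoSetoid (Fin 4)) //
      ∀ G : SimpleGraph (Fin 4), Quotient.mk (graphIsoSetoid (Fin 4)) G = q →
        UniversallySolvable G} = 4 := by
  let f : Fin 4 → {q : Quotient (graphIsoSetoid (Fin 4)) //
      ∀ G : SimpleGraph (Fin 4), Quotient.mk (graphIsoSetoid (Fin 4)) G = q →
        UniversallySolvable G} := fun i =>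
    ⟨Quotient.mk _ (solvableRepresentative i), fun G hG => by
      obtain ⟨e⟩ := Quotient.exact hG
      exact (universallySolvable_solvableRepresentative i).of_iso e.symm⟩
  have hf : Function.Bijective f := by
    refine ⟨fun i j hij => ?_, fun ⟨q, hq⟩ => ?_⟩
    · obtain ⟨e⟩ := Quotient.exact (congrArg Subtype.val hij)
      exact card_edgeFinset_solvableRepresentative_injective e.card_edgeFinset_eq
    · obtain ⟨G, rfl⟩ := Quotient.exists_rep q
      obtain ⟨i, hi⟩ := (hq G rfl).exists_iso_solvableRepresentative
      exact ⟨i, Subtype.ext (Quotient.sound hi)⟩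
  rw [← Nat.card_eq_of_bijective f hf, Nat.card_fin]
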